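/- arXiv:2312.09643 — 2 statements merged into one kernel-verified Lean document; each statement's English description precedes it below -/
import Mathlib

section
/- Let G be a finite group, let D and d_τ be positive integers, and let ω : G → M_D(ℂ) and τ : G → M_{d_τ}(ℂ) be matrix representations. Let Λ_L, Λ_R ∈ M_D(ℂ) and set Λ = Λ_R·Λ_L. Let X be a finite set; for each x ∈ X fix a row vector ℓ_x ∈ ℂ^D, fix a column vector ρ ∈ ℂ^D, for each (x,y) ∈ X×X fix B_{xy} ∈ M_{d_τ}(ℂ), and fix A ∈ M_{d_τ}(ℂ). For a sequence g⃗ = (g_1,…,g_m) ∈ G^m define p(x,g⃗) = ℓ_x·(Λ_L ω(g_m) Λ_R)·(Λ_L ω(g_{m−1}) Λ_R)⋯(Λ_L ω(g_1) Λ_R)·ρ and f_A(x,y,g⃗) = Tr( B_{xy}·τ(g_m)·[A·τ(g_{m−1})]·[A·τ(g_{m−2})]⋯[A·τ(g_1)] ) (bracketed factors in decreasing order of the index; empty product for m = 1). Define the identical-sequence correlator k_A(m) = |G|^{−m} Σ_{g⃗ ∈ G^m} Σ_{x,y ∈ X} f_A(x,y,g⃗)·p(x,g⃗)·p(y,g⃗)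 (note the SAME sequence g⃗ appears in both probability factors). On ℂ^{d_τ}⊗ℂ^D⊗ℂ^D define P = |G|^{−1} Σ_{g∈G} τ(g)⊗ω(g)⊗ω(g), Θ = P·( Σ_{x,y∈X} B_{xy} ⊗ (v·r_x) ⊗ (v·r_y) )·P where v = Λ_R·ρ (column), r_x = ℓ_x·Λ_L (row), and Φ = P·(A ⊗ Λ ⊗ Λ)·P. Then for every m ≥ 1, k_A(m) = Tr(Θ·Φ^{m−1}). -/
open Matrix Kronecker BigOperators

theorem aux_ofFn_rev {M : Type*} [Monoid M] (m : ℕ) (F : Fin (m + 1) → M) :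
    (List.ofFn F).reverse.prod =
      F (Fin.last m) * (List.ofFn fun i : Fin m => F i.castSucc).reverse.prod := by
  rw [List.ofFn_succ']
  simp [List.concat_eq_append]

theorem aux_sum_split {G R : Type*} [Fintype G] [AddCommMonoid R] (m : ℕ)
    (H : (Fin (m + 1) → G) → R) :
    ∑ g : Fin (m + 1) → G, H g = ∑ a : G, ∑ g : Fin m → G, H (Fin.snoc (α := fun _ => G) g a) := by
  rw [← (Fin.snocEquiv (fun _ => G)).sum_comp, Fintype.sum_prod_type]
  rfl

theorem aux_sum_prod {G R : Type*} [Fintype G] [Semiring R] (F : G → R) (m : ℕ) :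
    ∑ g : Fin m → G, (List.ofFn fun i => F (g i)).reverse.prod = (∑ a, F a) ^ m := by
  induction m with
  | zero => simp
  | succ n ih =>
    rw [aux_sum_split, pow_succ', ← ih, Finset.sum_mul]
    refine Finset.sum_congr rfl fun a _ => ?_
    rw [Finset.mul_sum]
    refine Finset.sum_congr rfl fun g _ => ?_
    rw [aux_ofFn_rev]
    simp

theorem aux_shift {M : Type*} [Monoid M] (L R : M) (m : ℕ) (w : Fin (m + 1) → M) :
    (List.ofFn fun i => L * w i * R).reverse.prod =
      L * (w (Fin.last m) * (List.ofFn fun i : Fin m => R * L * w i.castSucc).reverse.prod) * R := by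
  induction m with
  | zero => simp [mul_assoc]
  | succ n ih =>
    rw [aux_ofFn_rev, ih (fun i => w i.castSucc), aux_ofFn_rev n]
    simp only [mul_assoc]

theorem aux_kron {a b : Type*} [Fintype a] [Fintype b] [DecidableEq a] [DecidableEq b] (m : ℕ)
    (S : Fin m → Matrix a a ℂ) (T : Fin m → Matrix b b ℂ) :
    (List.ofFn fun i => S i ⊗ₖ T i).reverse.prod =
      (List.ofFn S).reverse.prod ⊗ₖ (List.ofFn T).reverse.prod := by
  induction m with
  | zero => simp
  | succ n ih =>
    rw [aux_ofFn_rev, aux_ofFn_rev n S, aux_ofFn_rev n T, ih, Matrix.mul_kronecker_mul]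

theorem aux_idem {G R : Type*} [Fintype G] [Group G] [Ring R] [Algebra ℂ R] (F : G → R)
    (hF : ∀ g h, F (g * h) = F g * F h) :
    ((Fintype.card G : ℂ)⁻¹ • ∑ g, F g) * ((Fintype.card G : ℂ)⁻¹ • ∑ g, F g) =
      (Fintype.card G : ℂ)⁻¹ • ∑ g, F g := by
  have h0 : (Fintype.card G : ℂ) ≠ 0 := by simp
  have h : (∑ g, F g) * (∑ g, F g) = (Fintype.card G : ℂ) • ∑ g, F g := by
    rw [Finset.sum_mul]
    have : ∀ g : G, F g * ∑ h, F h = ∑ h, F h := fun g => by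
      rw [Finset.mul_sum]
      simp only [← hF]
      exact Equiv.sum_comp (Equiv.mulLeft g) F
    simp [this, Nat.cast_smul_eq_nsmul]
  rw [smul_mul_smul_comm, h, smul_smul]
  congr 1
  field_simp

theorem aux_pow {R : Type*} [Ring R] (P C : R) (h : P * P = P) (m : ℕ) :
    P * (P * C * P) ^ m * P = P * (C * P) ^ m := by
  induction m with
  | zero => simp [h]
  | succ n ih =>
    have e : P * (P * C * P) ^ (n + 1) * P = (P * P) * C * (P * (P * C * P) ^ n * P) := by
      rw [pow_succ']; simp only [mul_assoc]
    rw [e, ih, h, pow_succ']; simp only [mul_assoc]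

theorem aux_p {n : Type*} [Fintype n] [DecidableEq n] (l r : n → ℂ) (L R W : Matrix n n ℂ) :
    l ⬝ᵥ (L * W * R).mulVec r = trace (vecMulVec (R.mulVec r) (l ᵥ* L) * W) := by
  rw [Matrix.vecMulVec_mul, Matrix.trace_vecMulVec, dotProduct_comm (R.mulVec r), ← Matrix.dotProduct_mulVec,
    ← Matrix.dotProduct_mulVec]
  simp [Matrix.mulVec_mulVec, Matrix.mul_assoc]

/-- Theorem 2 of the paper (generalized UIRS protocol with identical gate sequences):
the identical-sequence second-order correlator `k_A(m)` equals `Tr(Θ · Φ^{m-1})`.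
Sequence length `m ≥ 1` is represented as `m + 1` for `m : ℕ`, and a sequence
`(g_1, …, g_{m+1})` is a function `Fin (m+1) → G`.  Ordered products `M_m ⋯ M_1`
are expressed as `(List.ofFn f).reverse.prod`. -/
theorem statement2
    (G : Type) [Fintype G] [Group G]
    (D dτ : ℕ) (hD : 0 < D) (hdτ : 0 < dτ)
    (ω : G → Matrix (Fin D) (Fin D) ℂ)
    (τ : G → Matrix (Fin dτ) (Fin dτ) ℂ)
    (hω1 : ω 1 = 1) (hω : ∀ g h : G, ω (g * h) = ω g * ω h)
    (hτ1 : τ 1 = 1) (hτ : ∀ g h : G, τ (g * h) = τ g * τ h)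
    (ΛL ΛR Λ : Matrix (Fin D) (Fin D) ℂ) (hΛ : Λ = ΛR * ΛL)
    (X : Type) [Fintype X]
    (ℓ : X → Fin D → ℂ) (ρ : Fin D → ℂ)
    (B : X → X → Matrix (Fin dτ) (Fin dτ) ℂ)
    (A : Matrix (Fin dτ) (Fin dτ) ℂ)
    -- the outcome probability p(x, g⃗) = ℓ_x (Λ_L ω(g_m) Λ_R) ⋯ (Λ_L ω(g_1) Λ_R) ρ
    (p : X → (m : ℕ) → (Fin m → G) → ℂ)
    (hp : ∀ (x : X) (m : ℕ) (g : Fin m → G),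
      p x m g = ℓ x ⬝ᵥ ((List.ofFn fun i : Fin m => ΛL * ω (g i) * ΛR).reverse.prod).mulVec ρ)
    -- the sequence correlation function f_A(x, y, g⃗)
    (fA : X → X → (m : ℕ) → (Fin (m + 1) → G) → ℂ)
    (hfA : ∀ (x y : X) (m : ℕ) (g : Fin (m + 1) → G),
      fA x y m g =
        Matrix.trace (B x y * τ (g (Fin.last m)) *
          (List.ofFn fun i : Fin m => A * τ (g i.castSucc)).reverse.prod))
    -- the identical-sequence correlator k_A at sequence length m + 1
    (kA : ℕ → ℂ)
    (hkA : ∀ m : ℕ,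
      kA m = ((Fintype.card G : ℂ) ^ (m + 1))⁻¹ *
        ∑ g : Fin (m + 1) → G, ∑ x : X, ∑ y : X,
          fA x y m g * p x (m + 1) g * p y (m + 1) g)
    -- the group-averaged projector P on ℂ^{dτ} ⊗ ℂ^D ⊗ ℂ^D
    (P : Matrix (Fin dτ × Fin D × Fin D) (Fin dτ × Fin D × Fin D) ℂ)
    (hP : P = ((Fintype.card G : ℂ))⁻¹ • ∑ g : G, τ g ⊗ₖ (ω g ⊗ₖ ω g))
    -- the SPAM matrix Θ
    (Θ : Matrix (Fin dτ × Fin D × Fin D) (Fin dτ × Fin D × Fin D) ℂ)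
    (hΘ : Θ = P * (∑ x : X, ∑ y : X,
      B x y ⊗ₖ (vecMulVec (ΛR.mulVec ρ) (ℓ x ᵥ* ΛL) ⊗ₖ vecMulVec (ΛR.mulVec ρ) (ℓ y ᵥ* ΛL))) * P)
    -- the decay matrix Φ
    (Φ : Matrix (Fin dτ × Fin D × Fin D) (Fin dτ × Fin D × Fin D) ℂ)
    (hΦ : Φ = P * (A ⊗ₖ (Λ ⊗ₖ Λ)) * P) :
    ∀ m : ℕ, kA m = Matrix.trace (Θ * Φ ^ m) := by
  intro m
  set Rp : G → Matrix (Fin dτ × Fin D × Fin D) (Fin dτ × Fin D × Fin D) ℂ :=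
    fun g => τ g ⊗ₖ (ω g ⊗ₖ ω g) with hRp
  have hRmul : ∀ g h, Rp (g * h) = Rp g * Rp h := fun g h => by
    simp only [hRp, hτ, hω, Matrix.mul_kronecker_mul]
  have hPP : P * P = P := by rw [hP]; exact aux_idem Rp hRmul
  set C := A ⊗ₖ (Λ ⊗ₖ Λ) with hC
  set N : X → X → Matrix (Fin dτ × Fin D × Fin D) (Fin dτ × Fin D × Fin D) ℂ :=
    fun x y => B x y ⊗ₖ (vecMulVec (ΛR.mulVec ρ) (ℓ x ᵥ* ΛL) ⊗ₖ
      vecMulVec (ΛR.mulVec ρ) (ℓ y ᵥ* ΛL)) with hN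
  have key : ∀ (g : Fin (m + 1) → G) (x y : X), fA x y m g * p x (m + 1) g * p y (m + 1) g =
      trace (N x y * (Rp (g (Fin.last m)) *
        (List.ofFn fun i : Fin m => C * Rp (g i.castSucc)).reverse.prod)) := by
    intro g x y
    have e : (fun i : Fin m => C * Rp (g i.castSucc)) = fun i : Fin m =>
        (A * τ (g i.castSucc)) ⊗ₖ ((Λ * ω (g i.castSucc)) ⊗ₖ (Λ * ω (g i.castSucc))) := by
      funext i
      simp only [hC, hRp, Matrix.mul_kronecker_mul]
    rw [e, aux_kron, aux_kron]
    simp only [hN, hRp, ← Matrix.mul_kronecker_mul, Matrix.trace_kronecker]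
    rw [hfA, hp, hp, aux_shift ΛL ΛR m (fun i => ω (g i)), aux_p, aux_p, hΛ]
    simp only [Matrix.mul_assoc, _root_.mul_assoc]
  have hsum : ∑ g : Fin (m + 1) → G, (Rp (g (Fin.last m)) *
        (List.ofFn fun i : Fin m => C * Rp (g i.castSucc)).reverse.prod) =
      (∑ a, Rp a) * (C * ∑ a, Rp a) ^ m := by
    rw [aux_sum_split, Finset.mul_sum, ← aux_sum_prod (fun a => C * Rp a) m, Finset.sum_mul]
    refine Finset.sum_congr rfl fun a _ => ?_
    rw [Finset.mul_sum]
    refine Finset.sum_congr rfl fun g _ => ?_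
    simp
  have hPs : (∑ a, Rp a) = (Fintype.card G : ℂ) • P := by
    rw [hP, smul_smul, mul_inv_cancel₀ (by simp), one_smul]
  have hfin : kA m = trace ((∑ x, ∑ y, N x y) * (P * (C * P) ^ m)) := by
    rw [hkA]
    simp only [key]
    have : ∑ g : Fin (m + 1) → G, ∑ x : X, ∑ y : X, trace (N x y * (Rp (g (Fin.last m)) *
        (List.ofFn fun i : Fin m => C * Rp (g i.castSucc)).reverse.prod)) =
        trace ((∑ x, ∑ y, N x y) * ((∑ a, Rp a) * (C * ∑ a, Rp a) ^ m)) := by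
      rw [← hsum, Finset.mul_sum, Matrix.trace_sum]
      refine Finset.sum_congr rfl fun g _ => ?_
      simp only [Finset.sum_mul, Matrix.trace_sum]
    rw [this, hPs]
    have h0 : (Fintype.card G : ℂ) ≠ 0 := by simp
    rw [Matrix.mul_smul, smul_pow, smul_mul_smul_comm, ← pow_succ', Matrix.mul_smul,
      Matrix.trace_smul, smul_eq_mul, inv_mul_cancel_left₀ (pow_ne_zero _ h0)]
  rw [hfin, ← aux_pow P C hPP m, hΘ, hΦ]
  change trace (_ * _) = trace (P * (∑ x, ∑ y, N x y) * P * (P * C * P) ^ m)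
  generalize (P * C * P) ^ m = Q
  rw [Matrix.mul_assoc P (∑ x, ∑ y, N x y), Matrix.mul_assoc P (_ * P), Matrix.trace_mul_comm P]
  simp only [Matrix.mul_assoc]
end

section
/- Fix an integer n ≥ 1 and let d = 2^n. For every Pauli string W and all matrices M, N ∈ M_d(ℂ): Σ_{σ ∈ 𝒫⁰} Tr(WσWσ)·Tr(σM)·Tr(σN) = Tr(W M W N) − (1/d)·Tr(M)·Tr(N), where the sum ranges over the normalized nontrivial Pauli operators. -/
open Matrix Kronecker BigOperators

noncomputable section

/-- The 2×2 Pauli matrices `I₂, X, Y, Z`, indexed by `Fin 4`. -/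
def pauli : Fin 4 → Matrix (Fin 2) (Fin 2) ℂ
  | 0 => 1
  | 1 => !![0, 1; 1, 0]
  | 2 => !![0, -Complex.I; Complex.I, 0]
  | 3 => !![1, 0; 0, -1]

/-- The Pauli string `pauli (s 0) ⊗ ⋯ ⊗ pauli (s (n-1))`, realized as a matrix on
`ℂ^{2^n}` with the index set `Fin n → Fin 2` (so `d = 2^n`).  The string is trivial
(equal to `I_d`) exactly when `s = fun _ => 0`. -/
def pauliString {n : ℕ} (s : Fin n → Fin 4) :
    Matrix (Fin n → Fin 2) (Fin n → Fin 2) ℂ :=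
  Matrix.of fun i j => ∏ k : Fin n, pauli (s k) (i k) (j k)

/-- The normalized Pauli operator `σ_s / √d` with `d = 2^n`; these form the
orthonormal basis `𝒫` of `M_d(ℂ)` for the Hilbert–Schmidt inner product. -/
def normPauli {n : ℕ} (s : Fin n → Fin 4) :
    Matrix (Fin n → Fin 2) (Fin n → Fin 2) ℂ :=
  ((Real.sqrt (2 ^ n) : ℂ))⁻¹ • pauliString s

/-- The swap operator `F` on `ℂ^d ⊗ ℂ^d`, determined by `F (u ⊗ v) = v ⊗ u`. -/
def swapOp (I : Type*) [DecidableEq I] : Matrix (I × I) (I × I) ℂ :=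
  Matrix.of fun p q => if p.1 = q.2 ∧ p.2 = q.1 then 1 else 0

def pstr {n : ℕ} (f : Fin n → Matrix (Fin 2) (Fin 2) ℂ) :
    Matrix (Fin n → Fin 2) (Fin n → Fin 2) ℂ :=
  Matrix.of fun i j => ∏ k : Fin n, f k (i k) (j k)

lemma pauliString_eq {n : ℕ} (s : Fin n → Fin 4) :
    pauliString s = pstr (fun k => pauli (s k)) := rfl

lemma pstr_mul {n : ℕ} (f g : Fin n → Matrix (Fin 2) (Fin 2) ℂ) :
    pstr f * pstr g = pstr (fun k => f k * g k) := by
  ext i j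
  simp only [pstr, Matrix.mul_apply, Matrix.of_apply, ← Finset.prod_mul_distrib]
  rw [Finset.prod_univ_sum, Fintype.piFinset_univ]

lemma pstr_trace {n : ℕ} (f : Fin n → Matrix (Fin 2) (Fin 2) ℂ) :
    Matrix.trace (pstr f) = ∏ k, Matrix.trace (f k) := by
  simp only [pstr, Matrix.trace, Matrix.diag_apply, Matrix.of_apply]
  rw [Finset.prod_univ_sum, Fintype.piFinset_univ]

lemma pstr_smul {n : ℕ} (c : Fin n → ℂ) (f : Fin n → Matrix (Fin 2) (Fin 2) ℂ) :
    pstr (fun k => c k • f k) = (∏ k, c k) • pstr f := by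
  ext i j
  simp [pstr, Finset.prod_mul_distrib]

lemma pauli_sq (a : Fin 4) : pauli a * pauli a = 1 := by
  fin_cases a <;> ext i j <;> fin_cases i <;> fin_cases j <;>
    simp [pauli, Matrix.mul_apply, Fin.sum_univ_two]

lemma pauli_conj (a b : Fin 4) : ∃ c : ℂ, pauli a * pauli b * pauli a = c • pauli b := by
  have h : pauli a * pauli b * pauli a = (1 : ℂ) • pauli b ∨
      pauli a * pauli b * pauli a = (-1 : ℂ) • pauli b := by
    fin_cases a <;> fin_cases b <;>
      simp [pauli, ← Matrix.ext_iff, Fin.forall_fin_two, Matrix.mul_apply, Fin.sum_univ_two]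
  rcases h with h | h
  exacts [⟨_, h⟩, ⟨_, h⟩]

lemma pauli_complete (i j k l : Fin 2) :
    ∑ a, pauli a i j * pauli a k l = if i = l ∧ j = k then 2 else 0 := by
  fin_cases i <;> fin_cases j <;> fin_cases k <;> fin_cases l <;>
    simp [pauli, Fin.sum_univ_four] <;> norm_num

lemma string_sq {n : ℕ} (s : Fin n → Fin 4) : pauliString s * pauliString s = pstr 1 := by
  rw [pauliString_eq, pstr_mul]
  simp only [pauli_sq]
  rfl

lemma pstr_one {n : ℕ} : pstr (1 : Fin n → Matrix (Fin 2) (Fin 2) ℂ) = 1 := by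
  ext i j
  simp [pstr, Matrix.one_apply, Finset.prod_ite_zero, funext_iff]

lemma string_conj {n : ℕ} (w s : Fin n → Fin 4) : ∃ c : ℂ,
    pauliString w * pauliString s * pauliString w = c • pauliString s := by
  choose c hc using pauli_conj
  refine ⟨∏ k, c (w k) (s k), ?_⟩
  simp only [pauliString_eq, pstr_mul, hc, pstr_smul]

lemma string_complete {n : ℕ} (i j k l : Fin n → Fin 2) :
    ∑ s : Fin n → Fin 4, pauliString s i j * pauliString s k l
      = if i = l ∧ j = k then 2 ^ n else 0 := by
  simp only [pauliString, Matrix.of_apply, ← Finset.prod_mul_distrib]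
  have h := Finset.prod_univ_sum (fun _ : Fin n => (Finset.univ : Finset (Fin 4)))
    (fun m a => pauli a (i m) (j m) * pauli a (k m) (l m))
  rw [Fintype.piFinset_univ] at h
  rw [← h]
  simp only [pauli_complete]
  rw [Finset.prod_ite_zero]
  simp [funext_iff, forall_and]

lemma sum_trace {n : ℕ} (A B : Matrix (Fin n → Fin 2) (Fin n → Fin 2) ℂ) :
    ∑ s : Fin n → Fin 4, Matrix.trace (pauliString s * A) * Matrix.trace (pauliString s * B)
      = 2 ^ n * Matrix.trace (A * B) := by
  have h : ∀ s : Fin n → Fin 4,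
      Matrix.trace (pauliString s * A) * Matrix.trace (pauliString s * B)
      = ∑ i, ∑ j, ∑ k, ∑ l, (pauliString s i j * pauliString s k l) * (A j i * B l k) := by
    intro s
    simp only [Matrix.trace, Matrix.diag_apply, Matrix.mul_apply, Finset.sum_mul]
    refine Finset.sum_congr rfl fun i _ => Finset.sum_congr rfl fun j _ => ?_
    simp only [Finset.mul_sum]
    refine Finset.sum_congr rfl fun k _ => Finset.sum_congr rfl fun l _ => ?_
    ring
  simp only [h]
  rw [Finset.sum_comm]
  have h2 : ∀ i : Fin n → Fin 2, (∑ s : Fin n → Fin 4, ∑ j, ∑ k, ∑ l,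
      (pauliString s i j * pauliString s k l) * (A j i * B l k))
      = ∑ j, 2 ^ n * (A j i * B i j) := by
    intro i
    rw [Finset.sum_comm]
    refine Finset.sum_congr rfl fun j _ => ?_
    rw [Finset.sum_comm]
    have h3 : ∀ k : Fin n → Fin 2, (∑ s : Fin n → Fin 4, ∑ l,
      (pauliString s i j * pauliString s k l) * (A j i * B l k))
      = if j = k then 2 ^ n * (A j i * B i k) else 0 := by
      intro k
      rw [Finset.sum_comm]
      simp only [← Finset.sum_mul, string_complete]
      by_cases hjk : j = k <;> simp [hjk]
    simp only [h3]
    simp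
  simp only [h2]
  rw [Finset.sum_comm]
  simp only [Matrix.trace, Matrix.diag_apply, Matrix.mul_apply, Finset.mul_sum]

lemma trace_id {n : ℕ} : Matrix.trace (pstr (1 : Fin n → Matrix (Fin 2) (Fin 2) ℂ)) = 2 ^ n := by
  rw [pstr_trace]; simp

lemma sqrt_inv_sq (n : ℕ) :
    ((Real.sqrt (2 ^ n) : ℂ))⁻¹ * ((Real.sqrt (2 ^ n) : ℂ))⁻¹ = ((2 ^ n : ℂ))⁻¹ := by
  rw [← mul_inv, ← Complex.ofReal_mul, Real.mul_self_sqrt (by positivity)]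
  push_cast; rfl

lemma term_eq {n : ℕ} (w s : Fin n → Fin 4)
    (M N : Matrix (Fin n → Fin 2) (Fin n → Fin 2) ℂ) :
    Matrix.trace (pauliString w * normPauli s * pauliString w * normPauli s) *
        Matrix.trace (normPauli s * M) * Matrix.trace (normPauli s * N)
    = ((2 ^ n : ℂ))⁻¹ * (Matrix.trace (pauliString s * (pauliString w * M * pauliString w)) *
        Matrix.trace (pauliString s * N)) := by
  obtain ⟨c, hc⟩ := string_conj w s
  have h1 : Matrix.trace (pauliString s * (pauliString w * M * pauliString w))
      = c * Matrix.trace (pauliString s * M) := by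
    have : Matrix.trace (pauliString s * (pauliString w * M * pauliString w))
        = Matrix.trace (pauliString w * pauliString s * pauliString w * M) := by
      rw [← Matrix.mul_assoc, Matrix.trace_mul_comm]
      simp only [Matrix.mul_assoc]
    rw [this, hc]; simp
  have h2 : Matrix.trace (pauliString w * pauliString s * pauliString w * pauliString s)
      = c * 2 ^ n := by
    rw [hc, Matrix.smul_mul, string_sq, Matrix.trace_smul, trace_id, smul_eq_mul]
  have h3 := sqrt_inv_sq n
  have h4 : (2 ^ n : ℂ)⁻¹ * 2 ^ n = 1 := inv_mul_cancel₀ (pow_ne_zero n two_ne_zero)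
  rw [h1]
  simp only [normPauli, Matrix.mul_smul, Matrix.smul_mul, Matrix.trace_smul, smul_eq_mul, h2]
  generalize ((Real.sqrt (2 ^ n) : ℂ))⁻¹ = r at *
  generalize Matrix.trace (pauliString s * M) = a
  generalize Matrix.trace (pauliString s * N) = b
  calc _ = (r * r) * ((r * r) * 2 ^ n) * c * a * b := by ring
    _ = _ := by rw [h3, h4]; ring

/-- Trace identity over the nontrivial Pauli basis (Appendices B and C of the paper):
for every Pauli string `W` and all `M, N ∈ M_d(ℂ)`,
`Σ_{σ∈𝒫⁰} Tr(WσWσ)·Tr(σM)·Tr(σN) = Tr(WMWN) − (1/d)·Tr(M)·Tr(N)`. -/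
theorem statement7 (n : ℕ) (hn : 1 ≤ n) (sW : Fin n → Fin 4)
    (M N : Matrix (Fin n → Fin 2) (Fin n → Fin 2) ℂ) :
    ∑ s ∈ Finset.univ.filter (fun s : Fin n → Fin 4 => s ≠ fun _ => 0),
      Matrix.trace (pauliString sW * normPauli s * pauliString sW * normPauli s) *
        Matrix.trace (normPauli s * M) * Matrix.trace (normPauli s * N)
    = Matrix.trace (pauliString sW * M * pauliString sW * N) -
        ((2 ^ n : ℂ))⁻¹ * Matrix.trace M * Matrix.trace N := by
  simp only [term_eq]
  have h0 : pauliString (fun _ : Fin n => (0 : Fin 4)) = 1 := by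
    rw [← pstr_one]; rfl
  have h4 : (2 ^ n : ℂ)⁻¹ * 2 ^ n = 1 := inv_mul_cancel₀ (pow_ne_zero n two_ne_zero)
  rw [Finset.filter_ne', ← Finset.mul_sum, Finset.sum_erase_eq_sub (Finset.mem_univ _), sum_trace,
    h0, mul_sub, ← mul_assoc, h4, one_mul, Matrix.one_mul, Matrix.one_mul]
  have h5 : Matrix.trace (pauliString sW * M * pauliString sW) = Matrix.trace M := by
    rw [Matrix.trace_mul_comm, ← Matrix.mul_assoc, string_sq, pstr_one, Matrix.one_mul]
  rw [h5]; ring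
end
end
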